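/- Let N ≥ 1, let X : Fin (N+1) → ℝ and dt : Fin N → ℝ with dt_k > 0 for all k. For a > 0 set η_k(a) = exp(−a·dt_k), κ_k(a) = (1 − exp(−a·dt_k))/a, γ_k(a) = sqrt((1 − exp(−2a·dt_k))/(2a)), θ(a) = ( ∑_k (X_{k+1} − η_k(a) X_k) ) / ( ∑_k κ_k(a) ), and define the volatility estimator σ²(a) = (1/N) ∑_k ( (X_{k+1} − η_k(a) X_k − θ(a) κ_k(a)) / γ_k(a) )². Then lim_{a→0+} σ²(a) = (1/N) ∑_k (X_{k+1} − X_k − μ·dt_k)² / dt_k, where μ = ( ∑_k (X_{k+1} − X_k) ) / ( ∑_k dt_k ). -/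

import Mathlib

open Real Filter Topology BigOperators

/-- The difference quotient at zero of `a ↦ 1 - exp (-(a * d))`. -/
theorem tendsto_one_sub_exp_neg_mul_div (d : ℝ) :
    Tendsto (fun a : ℝ => (1 - Real.exp (-(a * d))) / a) (𝓝[>] 0) (𝓝 d) := by
  have h : HasDerivAt (fun a : ℝ => 1 - Real.exp (-(a * d))) d 0 := by
    simpa using ((((hasDerivAt_id (0 : ℝ)).mul_const d).neg).exp).const_sub 1
  refine (h.tendsto_slope_zero_right).congr fun a => ?_
  simp [div_eq_inv_mul]

/-- Zero mean-reversion limit of the volatility estimator: as `a → 0⁺`, the MLE estimator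
`σ²(a) = (1/N) ∑ ((X_{k+1} − η_k(a) X_k − θ(a) κ_k(a))/γ_k(a))²` tends to the Black–Scholes
MLE volatility estimator `(1/N) ∑ (X_{k+1} − X_k − μ dt_k)²/dt_k` with
`μ = (∑ (X_{k+1} − X_k))/(∑ dt_k)`. -/
theorem volatility_estimator_zero_mr_limit
    (N : ℕ) (hN : 1 ≤ N) (X : Fin (N + 1) → ℝ) (dt : Fin N → ℝ)
    (hdt : ∀ k, 0 < dt k)
    (η κ γ : ℝ → Fin N → ℝ)
    (hη : ∀ a k, η a k = Real.exp (-(a * dt k)))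
    (hκ : ∀ a k, κ a k = (1 - Real.exp (-(a * dt k))) / a)
    (hγ : ∀ a k, γ a k = Real.sqrt ((1 - Real.exp (-(2 * a * dt k))) / (2 * a)))
    (θ : ℝ → ℝ)
    (hθ : ∀ a : ℝ, θ a = (∑ k : Fin N, (X k.succ - η a k * X k.castSucc)) /
      (∑ k : Fin N, κ a k))
    (σsq : ℝ → ℝ)
    (hσ : ∀ a : ℝ, σsq a = (1 / N) *
      ∑ k : Fin N, ((X k.succ - η a k * X k.castSucc - θ a * κ a k) / γ a k) ^ 2)
    (μ : ℝ)
    (hμ : μ = (∑ k : Fin N, (X k.succ - X k.castSucc)) / (∑ k : Fin N, dt k)) :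
    Tendsto σsq (𝓝[>] 0)
      (𝓝 ((1 / N) * ∑ k : Fin N, (X k.succ - X k.castSucc - μ * dt k) ^ 2 / dt k)) := by
  have : Nonempty (Fin N) := ⟨⟨0, hN⟩⟩
  have hsum : ∑ k : Fin N, dt k ≠ 0 :=
    (Finset.sum_pos (fun k _ => hdt k) Finset.univ_nonempty).ne'
  have tη (k : Fin N) : Tendsto (fun a => η a k) (𝓝[>] 0) (𝓝 1) := by
    simp only [hη]
    have hc : Continuous fun a : ℝ => Real.exp (-(a * dt k)) := by fun_prop
    simpa using (hc.tendsto 0).mono_left nhdsWithin_le_nhds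
  have tκ (k : Fin N) : Tendsto (fun a => κ a k) (𝓝[>] 0) (𝓝 (dt k)) := by
    simpa only [hκ] using tendsto_one_sub_exp_neg_mul_div (dt k)
  have tγ (k : Fin N) : Tendsto (fun a => γ a k) (𝓝[>] 0) (𝓝 (√(dt k))) := by
    simp only [hγ]
    refine Tendsto.sqrt ((tendsto_one_sub_exp_neg_mul_div (dt k)).comp
      (tendsto_nhdsWithin_iff.2 ⟨?_, ?_⟩))
    · have hc : Continuous fun a : ℝ => 2 * a := by fun_prop
      simpa using (hc.tendsto 0).mono_left nhdsWithin_le_nhds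
    · filter_upwards [self_mem_nhdsWithin] with a (ha : 0 < a)
      exact mul_pos two_pos ha
  have tincr (k : Fin N) : Tendsto (fun a => X k.succ - η a k * X k.castSucc) (𝓝[>] 0)
      (𝓝 (X k.succ - X k.castSucc)) := by
    simpa using ((tη k).mul_const (X k.castSucc)).const_sub (X k.succ)
  have tθ : Tendsto θ (𝓝[>] 0) (𝓝 μ) := by
    rw [funext hθ, hμ]
    exact (tendsto_finsetSum _ fun k _ => tincr k).div (tendsto_finsetSum _ fun k _ => tκ k) hsum
  rw [funext hσ]
  refine (tendsto_finsetSum _ fun k _ => ?_).const_mul _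
  have h := (((tincr k).sub (tθ.mul (tκ k))).div (tγ k) (Real.sqrt_pos.2 (hdt k)).ne').pow 2
  rwa [div_pow _ (√(dt k)), Real.sq_sqrt (hdt k).le] at h
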